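/- arXiv:2302.10807 — 4 statements merged into one kernel-verified Lean document; each statement's English description precedes it below -/
import Mathlib

section
/- Let U = {(z₁, z₂) ∈ ℂ² : |z₁| < 3/2 and |z₂| < 3/2} and V = U \ {(0,0)}. For every function f : ℂ² → ℂ that is holomorphic on V and bounded on V, there exists a function F : ℂ² → ℂ holomorphic on U such that F(z) = f(z) for all z ∈ V; moreover any two functions holomorphic on U that agree with f on V agree on all of U, and sup_{z ∈ U} |F(z)| = sup_{z ∈ V} |f(z)|. -/
open Set Filter Topology Metric MeasureTheory

/-- **Cauchy estimate**: a holomorphic function bounded by `M` on a ball of radius `r` has derivative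
of norm at most `2 * M / r` at the center. -/
theorem norm_fderiv_le_of_forall_mem_ball_norm_le {E : Type*} [NormedAddCommGroup E]
    [NormedSpace ℂ E] {g : E → ℂ} {x : E} {r M : ℝ} (hr : 0 < r)
    (hd : DifferentiableOn ℂ g (ball x r)) (hM : ∀ y ∈ ball x r, ‖g y‖ ≤ M) :
    ‖fderiv ℂ g x‖ ≤ 2 * M / r := by
  refine Complex.norm_fderiv_le_div_of_mapsTo_ball hd (fun y hy => ?_) hr
  rw [mem_closedBall, dist_eq_norm]
  linarith [norm_sub_le (g y) (g x), hM y hy, hM x (mem_ball_self hr)]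

/-- A circle integral depending holomorphically and boundedly on a parameter is differentiable
in that parameter. -/
theorem differentiableAt_circleIntegral_of_norm_le {E : Type*} [NormedAddCommGroup E]
    [NormedSpace ℂ E] [FiniteDimensional ℂ E] {K : E × ℂ → ℂ} {x₀ : E} {c : ℂ} {R r M : ℝ}
    (hR : 0 ≤ R) (hr : 0 < r)
    (hd : ∀ x ∈ ball x₀ r, ∀ ζ ∈ sphere c R, DifferentiableAt ℂ K (x, ζ))
    (hM : ∀ x ∈ ball x₀ r, ∀ ζ ∈ sphere c R, ‖K (x, ζ)‖ ≤ M) :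
    DifferentiableAt ℂ (fun x => ∮ ζ in C(c, R), K (x, ζ)) x₀ := by
  have hmem (θ : ℝ) : circleMap c R θ ∈ sphere c R := circleMap_mem_sphere c hR θ
  have hslice (x : E) (hx : x ∈ ball x₀ r) (θ : ℝ) :
      HasFDerivAt (fun y => K (y, circleMap c R θ))
        ((fderiv ℂ K (x, circleMap c R θ)).comp (ContinuousLinearMap.inl ℂ E ℂ)) x :=
    (hd x hx _ (hmem θ)).hasFDerivAt.comp x (hasFDerivAt_prodMk_left x _)
  have hcont (x : E) (hx : x ∈ ball x₀ r) :
      Continuous fun θ : ℝ => deriv (circleMap c R) θ • K (x, circleMap c R θ) := by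
    have hK : Continuous fun θ : ℝ => K (x, circleMap c R θ) :=
      continuous_iff_continuousAt.2 fun θ =>
        ContinuousAt.comp (f := fun θ : ℝ => (x, circleMap c R θ))
          (hd x hx _ (hmem θ)).continuousAt (by fun_prop)
    simp only [deriv_circleMap]
    exact ((continuous_circleMap 0 R).mul continuous_const).smul hK
  have hsub (x : E) (hx : x ∈ ball x₀ (r / 2)) : ball x (r / 2) ⊆ ball x₀ r :=
    ball_subset_ball' (by linarith [mem_ball.1 hx])
  have hself (x : E) (hx : x ∈ ball x₀ (r / 2)) : x ∈ ball x₀ r :=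
    hsub x hx (mem_ball_self (half_pos hr))
  have : ProperSpace E := FiniteDimensional.proper ℂ E
  have : ProperSpace (E →L[ℂ] ℂ) := FiniteDimensional.proper ℂ _
  borelize E
  have hmeas : Measurable fun θ : ℝ => deriv (circleMap c R) θ •
      (fderiv ℂ K (x₀, circleMap c R θ)).comp (ContinuousLinearMap.inl ℂ E ℂ) := by
    have hK : Measurable fun θ : ℝ => fderiv ℂ K (x₀, circleMap c R θ) :=
      (measurable_fderiv ℂ K).comp (by fun_prop)
    have hL : Continuous fun L : E × ℂ →L[ℂ] ℂ => L.comp (ContinuousLinearMap.inl ℂ E ℂ) := by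
      fun_prop
    exact (measurable_deriv (circleMap c R)).smul (hL.measurable.comp hK)
  refine (intervalIntegral.hasFDerivAt_integral_of_dominated_of_fderiv_le
    (F' := fun x θ => deriv (circleMap c R) θ •
      (fderiv ℂ K (x, circleMap c R θ)).comp (ContinuousLinearMap.inl ℂ E ℂ))
    (bound := fun _ => R * (2 * M / (r / 2))) (ball_mem_nhds x₀ (half_pos hr))
    ?_ ?_ hmeas.stronglyMeasurable.aestronglyMeasurable ?_ ?_ ?_).differentiableAt
  · filter_upwards [ball_mem_nhds x₀ hr] with x hx
    exact (hcont x hx).aestronglyMeasurable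
  · exact (hcont x₀ (mem_ball_self hr)).intervalIntegrable _ _
  · refine .of_forall fun θ _ x hx => ?_
    rw [norm_smul, ← (hslice x (hself x hx) θ).fderiv]
    refine mul_le_mul (by simp [abs_of_nonneg hR]) ?_ (norm_nonneg _) hR
    exact norm_fderiv_le_of_forall_mem_ball_norm_le (half_pos hr)
      (fun y hy => (hslice y (hsub x hx hy) θ).differentiableAt.differentiableWithinAt)
      fun y hy => hM y (hsub x hx hy) _ (hmem θ)
  · exact intervalIntegrable_const
  · exact .of_forall fun θ _ x hx => (hslice x (hself x hx) θ).fun_const_smul _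

/-- The point `(0, w)` is the limit of `(t, w)` as `t` tends to `0` with `t ≠ 0`. -/
theorem tendsto_prodMk_left_punctured (w : ℂ) :
    Tendsto (fun t : ℂ => (t, w)) (𝓝[≠] 0) (𝓝 (0, w)) :=
  (Continuous.tendsto (by fun_prop : Continuous fun t : ℂ => (t, w)) 0).mono_left
    nhdsWithin_le_nhds

/-- **Removable singularity in two variables**: a bounded holomorphic function on a punctured bidisc
of radius larger than one agrees near the puncture with a function differentiable there. -/
theorem exists_differentiableAt_of_bounded_on_punctured_ball {f : ℂ × ℂ → ℂ} {ρ C : ℝ}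
    (hρ : 1 < ρ) (hd : ∀ z ∈ ball (0 : ℂ × ℂ) ρ, z ≠ 0 → DifferentiableAt ℂ f z)
    (hC : ∀ z ∈ ball (0 : ℂ × ℂ) ρ, z ≠ 0 → ‖f z‖ ≤ C) :
    ∃ G : ℂ × ℂ → ℂ, DifferentiableAt ℂ G 0 ∧ ∀ᶠ z in 𝓝[≠] 0, G z = f z := by
  have hball {z : ℂ × ℂ} {s : ℝ} : z ∈ ball (0 : ℂ × ℂ) s ↔ ‖z.1‖ < s ∧ ‖z.2‖ < s := by
    rw [mem_ball_zero_iff, Prod.norm_def, max_lt_iff]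
  let K : (ℂ × ℂ) × ℂ → ℂ := fun q => (q.2 - q.1.2)⁻¹ • f (q.1.1, q.2)
  let G : ℂ × ℂ → ℂ := fun p => (2 * Real.pi * Complex.I : ℂ)⁻¹ • ∮ ζ in C(0, 1), K (p, ζ)
  have hK (p : ℂ × ℂ) (hp : p ∈ ball (0 : ℂ × ℂ) (1 / 2)) (ζ : ℂ) (hζ : ζ ∈ sphere (0 : ℂ) 1) :
      DifferentiableAt ℂ K (p, ζ) ∧ ‖K (p, ζ)‖ ≤ 2 * C := by
    rw [hball] at hp
    rw [mem_sphere_zero_iff_norm] at hζ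
    have hlow : 1 / 2 ≤ ‖ζ - p.2‖ := by linarith [norm_sub_norm_le ζ p.2, hp.2]
    have hne : ζ - p.2 ≠ 0 := norm_pos_iff.1 (by linarith)
    have hmem : (p.1, ζ) ∈ ball (0 : ℂ × ℂ) ρ :=
      hball.2 ⟨by dsimp only; linarith [hp.1], by dsimp only; linarith⟩
    have hne0 : (p.1, ζ) ≠ (0 : ℂ × ℂ) := fun h => by
      have h2 : ζ = 0 := (Prod.ext_iff.1 h).2
      simp [h2] at hζ
    constructor
    · have hf : DifferentiableAt ℂ (fun q : (ℂ × ℂ) × ℂ => f (q.1.1, q.2)) (p, ζ) :=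
        DifferentiableAt.comp (f := fun q : (ℂ × ℂ) × ℂ => (q.1.1, q.2)) (p, ζ)
          (hd _ hmem hne0) (by fun_prop)
      have hsub : DifferentiableAt ℂ (fun q : (ℂ × ℂ) × ℂ => q.2 - q.1.2) (p, ζ) := by fun_prop
      exact (hsub.fun_inv hne).fun_smul hf
    · rw [norm_smul, norm_inv]
      refine mul_le_mul ?_ (hC _ hmem hne0) (norm_nonneg _) (by norm_num)
      rw [inv_le_comm₀ (by linarith) (by norm_num)]
      linarith
  have hGd (p : ℂ × ℂ) (hp : p ∈ ball (0 : ℂ × ℂ) (1 / 2)) : DifferentiableAt ℂ G p := by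
    obtain ⟨r, hr, hsub⟩ := Metric.isOpen_iff.1 isOpen_ball p hp
    exact (differentiableAt_circleIntegral_of_norm_le zero_le_one hr
      (fun x hx ζ hζ => (hK x (hsub hx) ζ hζ).1)
      (fun x hx ζ hζ => (hK x (hsub hx) ζ hζ).2)).fun_const_smul _
  have hcauchy (p : ℂ × ℂ) (hp : p ∈ ball (0 : ℂ × ℂ) (1 / 2)) (hp1 : p.1 ≠ 0) : G p = f p := by
    rw [hball] at hp
    have hf : DifferentiableOn ℂ (fun ζ => f (p.1, ζ)) (closedBall 0 1) := fun ζ hζ => by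
      rw [mem_closedBall_zero_iff] at hζ
      refine (DifferentiableAt.comp (f := fun ζ : ℂ => (p.1, ζ)) ζ (hd _ ?_ ?_)
        (by fun_prop)).differentiableWithinAt
      · exact hball.2 ⟨by dsimp only; linarith [hp.1], by dsimp only; linarith⟩
      · exact fun h => hp1 (Prod.ext_iff.1 h).1
    have hw : p.2 ∈ ball (0 : ℂ) 1 := by
      rw [mem_ball_zero_iff]
      linarith [hp.2]
    have hcl : DiffContOnCl ℂ (fun ζ => f (p.1, ζ)) (ball 0 1) :=
      (hf.mono closure_ball_subset_closedBall).diffContOnCl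
    have hformula := hcl.two_pi_i_inv_smul_circleIntegral_sub_inv_smul hw
    exact hformula
  refine ⟨G, hGd 0 (mem_ball_self (by norm_num)), ?_⟩
  filter_upwards [mem_nhdsWithin_of_mem_nhds (ball_mem_nhds (0 : ℂ × ℂ) one_half_pos),
    self_mem_nhdsWithin] with p hp hp0
  by_cases hp1 : p.1 = 0
  · obtain ⟨z, w⟩ := p
    obtain rfl : z = 0 := hp1
    have hlim := tendsto_prodMk_left_punctured w
    have hfc : ContinuousAt f (0, w) :=
      (hd _ (ball_subset_ball (by linarith) hp) hp0).continuousAt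
    refine tendsto_nhds_unique (((hGd _ hp).continuousAt.tendsto).comp hlim)
      ((hfc.tendsto.comp hlim).congr' ?_)
    filter_upwards [hlim.eventually (isOpen_ball.mem_nhds hp), self_mem_nhdsWithin] with t ht ht0
    exact (hcauchy _ ht ht0).symm
  · exact hcauchy p hp hp1


/-- Hartogs-type extension on the punctured bidisc: with
`U = {(z₁, z₂) : |z₁| < 3/2, |z₂| < 3/2}` and `V = U \ {(0,0)}`, every bounded holomorphic
function on `V` extends to a holomorphic function `F` on `U`; the extension is unique, and
`sup_{U} |F| = sup_{V} |f|`. -/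
theorem hartogs_extension_punctured_bidisc
    (U V : Set (ℂ × ℂ))
    (hU : U = {z : ℂ × ℂ | ‖z.1‖ < 3 / 2 ∧ ‖z.2‖ < 3 / 2})
    (hV : V = U \ {(0, 0)})
    (f : ℂ × ℂ → ℂ) (hf : DifferentiableOn ℂ f V)
    (hb : ∃ C : ℝ, ∀ z ∈ V, ‖f z‖ ≤ C) :
    ∃ F : ℂ × ℂ → ℂ, DifferentiableOn ℂ F U ∧ (∀ z ∈ V, F z = f z) ∧
      (∀ G H : ℂ × ℂ → ℂ, DifferentiableOn ℂ G U → DifferentiableOn ℂ H U →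
        (∀ z ∈ V, G z = f z) → (∀ z ∈ V, H z = f z) → ∀ z ∈ U, G z = H z) ∧
      sSup ((fun z => ‖F z‖) '' U) = sSup ((fun z => ‖f z‖) '' V) := by
  obtain ⟨C, hC⟩ := hb
  have hball : U = ball (0 : ℂ × ℂ) (3 / 2) := by
    ext z
    rw [hU, mem_ball_zero_iff, Prod.norm_def, max_lt_iff, mem_ofPred_eq]
  have hUo : IsOpen U := hball ▸ isOpen_ball
  have hVo : IsOpen V := hV ▸ hUo.sdiff isClosed_singleton
  have h0U : (0 : ℂ × ℂ) ∈ U := hball ▸ mem_ball_self (by norm_num)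
  have hmemV (z : ℂ × ℂ) (hz : z ∈ U) (hz0 : z ≠ 0) : z ∈ V := hV ▸ ⟨hz, hz0⟩
  have hVU : V ⊆ U := hV ▸ sdiff_subset
  have hV0 : ∀ z ∈ V, z ≠ 0 := fun z hz => (hV ▸ hz : z ∈ U \ {(0, 0)}).2
  have hVnhds : ∀ᶠ z in 𝓝[≠] (0 : ℂ × ℂ), z ∈ V := by
    filter_upwards [mem_nhdsWithin_of_mem_nhds (hUo.mem_nhds h0U), self_mem_nhdsWithin]
      with z hz hz0 using hmemV z hz hz0
  obtain ⟨G, hG, hGf⟩ := exists_differentiableAt_of_bounded_on_punctured_ball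
    (f := f) (ρ := 3 / 2) (C := C) (by norm_num)
    (fun z hz hz0 => hf.differentiableAt (hVo.mem_nhds (hmemV z (hball ▸ hz) hz0)))
    (fun z hz hz0 => hC z (hmemV z (hball ▸ hz) hz0))
  let F : ℂ × ℂ → ℂ := Function.update f 0 (G 0)
  have hFV : ∀ z ∈ V, F z = f z := fun z hz => Function.update_of_ne (hV0 z hz) _ _
  have hF0 : DifferentiableAt ℂ F 0 := by
    refine hG.congr_of_eventuallyEq ?_
    filter_upwards [eventually_nhdsWithin_iff.1 hGf] with z hz
    by_cases hz0 : z = 0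
    · simp [F, hz0]
    · rw [hz hz0]
      exact Function.update_of_ne hz0 _ _
  have hFU : DifferentiableOn ℂ F U := fun z hz => by
    by_cases hz0 : z = 0
    · exact hz0 ▸ hF0.differentiableWithinAt
    · have hzV := hVo.mem_nhds (hmemV z hz hz0)
      exact ((hf.differentiableAt hzV).congr_of_eventuallyEq
        (eventually_of_mem hzV hFV)).differentiableWithinAt
  refine ⟨F, hFU, hFV, fun A B hA hB hAf hBf z hz => ?_, ?_⟩
  · by_cases hz0 : z = 0
    · subst hz0
      have hlim {D : ℂ × ℂ → ℂ} (hD : DifferentiableOn ℂ D U) :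
          Tendsto D (𝓝[≠] 0) (𝓝 (D 0)) :=
        (hD.continuousOn.continuousAt (hUo.mem_nhds h0U)).tendsto.mono_left nhdsWithin_le_nhds
      refine tendsto_nhds_unique (hlim hA) ((hlim hB).congr' ?_)
      filter_upwards [hVnhds] with z hz
      rw [hAf z hz, hBf z hz]
    · rw [hAf z (hmemV z hz hz0), hBf z (hmemV z hz hz0)]
  · have hbdd : BddAbove ((fun z => ‖f z‖) '' V) := ⟨C, forall_mem_image.2 hC⟩
    have hle : ∀ z ∈ U, ‖F z‖ ≤ sSup ((fun z => ‖f z‖) '' V) := fun z hz => by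
      by_cases hz0 : z = 0
      · subst hz0
        refine le_of_tendsto (hF0.continuousAt.norm.tendsto.mono_left
          (nhdsWithin_le_nhds (s := {0}ᶜ))) ?_
        filter_upwards [hVnhds] with z hz
        rw [hFV z hz]
        exact le_csSup hbdd (mem_image_of_mem _ hz)
      · rw [hFV z (hmemV z hz hz0)]
        exact le_csSup hbdd (mem_image_of_mem _ (hmemV z hz hz0))
    refine le_antisymm (csSup_le (nonempty_of_mem h0U |>.image _) (forall_mem_image.2 hle)) ?_
    obtain ⟨v, hv⟩ := hVnhds.exists
    refine csSup_le ⟨_, mem_image_of_mem _ hv⟩ (forall_mem_image.2 fun z hz => ?_)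
    rw [← hFV z hz]
    exact le_csSup ⟨_, forall_mem_image.2 hle⟩ (mem_image_of_mem _ (hVU hz))
end

section
/- Let E be a real normed space and let x ∈ E. Then sup { Σ_{i=1}^m |x_i^*(x)| : m ∈ ℕ, x_1^*, …, x_m^* ∈ E*, and sup_{y ∈ B_E} Σ_{i=1}^m |x_i^*(y)| ≤ 1 } = ‖x‖. (This expresses that the canonical map δ_E : E → FBL[E], x ↦ δ_x with δ_x(x*) = x*(x), is a linear isometry for the free Banach lattice norm ‖f‖ = sup { Σ_{i=1}^m |f(x_i^*)| : sup_{y ∈ B_E} Σ_{i=1}^m |x_i^*(y)| ≤ 1 }.) -/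
/-- The canonical map `δ_E : E → FBL[E]` is an isometry: for every `x` in a real normed
space `E`, the supremum of `∑ᵢ |xᵢ*(x)|` over all finite families `x₁*, …, x_m*` of
continuous functionals with `sup_{y ∈ B_E} ∑ᵢ |xᵢ*(y)| ≤ 1` equals `‖x‖`. -/
theorem fbl_delta_isometry {E : Type*} [NormedAddCommGroup E] [NormedSpace ℝ E] (x : E) :
    sSup {r : ℝ | ∃ (m : ℕ) (φ : Fin m → StrongDual ℝ E),
      (∀ y : E, ‖y‖ ≤ 1 → ∑ i, |φ i y| ≤ 1) ∧ r = ∑ i, |φ i x|} = ‖x‖ := by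
  apply IsGreatest.csSup_eq
  constructor
  · obtain ⟨g, hg, hgx⟩ := exists_dual_vector'' ℝ x
    refine ⟨1, fun _ => g, fun y hy => ?_, by simp [hgx]⟩
    simpa using g.le_of_opNorm_le_of_le hg hy
  · rintro r ⟨m, φ, hφ, rfl⟩
    rcases eq_or_ne x 0 with rfl | hx
    · simp
    have hpos : 0 < ‖x‖ := norm_pos_iff.mpr hx
    have h := hφ (‖x‖⁻¹ • x) (by simp [norm_smul, hpos.ne'])
    simp only [map_smul, smul_eq_mul, abs_mul, abs_inv, abs_norm, ← Finset.mul_sum] at h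
    rwa [inv_mul_le_iff₀ hpos, mul_one] at h
end

section
/- Let X₀, X₁, X₂ be real Banach lattices and let T₁ : X₀ → X₁ and T₂ : X₀ → X₂ be isometric lattice embeddings. Then there exist a real Banach lattice X₃ and isometric lattice embeddings S₁ : X₁ → X₃ and S₂ : X₂ → X₃ such that S₁ ∘ T₁ = S₂ ∘ T₂. -/
universe u v w

/-- A seminorm on a vector lattice is solid if it is monotone in the absolute value. -/
class HasSolidSeminorm (V : Type*) [SeminormedAddCommGroup V] [Lattice V] : Prop where
  solid : ∀ ⦃x y : V⦄, |x| ≤ |y| → ‖x‖ ≤ ‖y‖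

namespace HasSolidSeminorm

open UniformSpace

variable {V : Type*} [SeminormedAddCommGroup V] [Lattice V] [HasSolidSeminorm V]
  [IsOrderedAddMonoid V]

theorem norm_abs_eq (x : V) : ‖|x|‖ = ‖x‖ :=
  (solid (abs_abs x).le).antisymm (solid (abs_abs x).ge)

theorem norm_sup_sub_sup_le (a b c d : V) : ‖a ⊔ b - c ⊔ d‖ ≤ ‖a - c‖ + ‖b - d‖ := by
  have h₁ : ‖a ⊔ b - c ⊔ b‖ ≤ ‖a - c‖ := solid (abs_sup_sub_sup_le_abs a c b)
  have h₂ : ‖c ⊔ b - c ⊔ d‖ ≤ ‖b - d‖ := by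
    rw [sup_comm c b, sup_comm c d]
    exact solid (abs_sup_sub_sup_le_abs b d c)
  calc ‖a ⊔ b - c ⊔ d‖ = ‖(a ⊔ b - c ⊔ b) + (c ⊔ b - c ⊔ d)‖ := by rw [sub_add_sub_cancel]
    _ ≤ ‖a - c‖ + ‖b - d‖ := (norm_add_le _ _).trans (add_le_add h₁ h₂)

theorem uniformContinuous₂_sup : UniformContinuous₂ ((· ⊔ ·) : V → V → V) := by
  refine Metric.uniformContinuous_iff.2 fun ε hε => ⟨ε / 2, half_pos hε, ?_⟩
  rintro ⟨a, b⟩ ⟨c, d⟩ h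
  rw [Prod.dist_eq, sup_lt_iff, dist_eq_norm, dist_eq_norm] at h
  simp only [Function.uncurry_apply_pair, dist_eq_norm]
  linarith [norm_sup_sub_sup_le a b c d]

theorem uniformContinuous₂_inf : UniformContinuous₂ ((· ⊓ ·) : V → V → V) := by
  have h : ((· ⊓ ·) : V → V → V) = fun a b => -(-a ⊔ -b) := by
    funext a b
    simp [neg_sup]
  rw [h]
  have hs : UniformContinuous₂ fun a b : V => -a ⊔ -b :=
    uniformContinuous₂_sup.bicompl uniformContinuous_neg uniformContinuous_neg
  exact hs.neg

noncomputable instance : Max (Completion V) := ⟨Completion.map₂ (· ⊔ ·)⟩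

noncomputable instance : Min (Completion V) := ⟨Completion.map₂ (· ⊓ ·)⟩

theorem coe_max (a b : V) : ((a ⊔ b : V) : Completion V) = (a : Completion V) ⊔ b :=
  (Completion.map₂_coe_coe a b _ uniformContinuous₂_sup).symm

theorem coe_min (a b : V) : ((a ⊓ b : V) : Completion V) = (a : Completion V) ⊓ b :=
  (Completion.map₂_coe_coe a b _ uniformContinuous₂_inf).symm

instance : ContinuousSup (Completion V) :=
  ⟨Completion.continuous_map₂ continuous_fst continuous_snd⟩

instance : ContinuousInf (Completion V) :=
  ⟨Completion.continuous_map₂ continuous_fst continuous_snd⟩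

noncomputable instance : Lattice (Completion V) :=
  Lattice.mk'
    (fun a b => Completion.induction_on₂ a b
      (isClosed_eq (by fun_prop) (by fun_prop)) fun a b => by
        rw [← coe_max, ← coe_max, sup_comm])
    (fun a b c => Completion.induction_on₃ a b c
      (isClosed_eq (by fun_prop) (by fun_prop)) fun a b c => by
        simp only [← coe_max, sup_assoc])
    (fun a b => Completion.induction_on₂ a b
      (isClosed_eq (by fun_prop) (by fun_prop)) fun a b => by
        rw [← coe_min, ← coe_min, inf_comm])
    (fun a b c => Completion.induction_on₃ a b c
      (isClosed_eq (by fun_prop) (by fun_prop)) fun a b c => by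
        simp only [← coe_min, inf_assoc])
    (fun a b => Completion.induction_on₂ a b
      (isClosed_eq (by fun_prop) (by fun_prop)) fun a b => by
        rw [← coe_min, ← coe_max, sup_inf_self])
    (fun a b => Completion.induction_on₂ a b
      (isClosed_eq (by fun_prop) (by fun_prop)) fun a b => by
        rw [← coe_max, ← coe_min, inf_sup_self])

theorem coe_sup (a b : V) : ((a ⊔ b : V) : Completion V) = (a : Completion V) ⊔ b :=
  coe_max a b

theorem completion_sup_add (a b c : Completion V) : (a ⊔ b) + c = (a + c) ⊔ (b + c) :=
  Completion.induction_on₃ a b c (isClosed_eq (by fun_prop) (by fun_prop)) fun a b c => by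
    simp only [← coe_sup, ← Completion.coe_add, sup_add]

instance : IsOrderedAddMonoid (Completion V) where
  add_le_add_left a b h c := by
    rw [← sup_eq_right] at h ⊢
    rw [← completion_sup_add, h]

theorem completion_norm_abs (a : Completion V) : ‖|a|‖ = ‖a‖ :=
  Completion.induction_on a
    (isClosed_eq (by unfold abs; fun_prop) (by fun_prop)) fun a => by
      rw [abs, ← Completion.coe_neg, ← coe_sup, Completion.norm_coe, Completion.norm_coe]
      exact norm_abs_eq a

theorem completion_norm_le_norm_abs_sup (a b : Completion V) : ‖a‖ ≤ ‖|a| ⊔ |b|‖ :=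
  Completion.induction_on₂ a b
    (isClosed_le (by fun_prop) (by unfold abs; fun_prop)) fun a b => by
      simp only [abs, ← Completion.coe_neg, ← coe_sup, Completion.norm_coe]
      exact solid (le_sup_left.trans (le_abs_self (|a| ⊔ |b|)))

instance : HasSolidNorm (Completion V) where
  solid a b h := by
    have h' := completion_norm_le_norm_abs_sup a b
    rwa [sup_eq_right.2 h, completion_norm_abs] at h'

variable [NormedSpace ℝ V] [PosSMulMono ℝ V]

theorem smul_sup_of_nonneg {W : Type*} [AddCommGroup W] [Lattice W] [Module ℝ W]
    [PosSMulMono ℝ W] {r : ℝ} (hr : 0 ≤ r) (a b : W) : r • (a ⊔ b) = r • a ⊔ r • b := by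
  rcases hr.eq_or_lt with rfl | hr
  · simp
  · exact (OrderIso.smulRight hr).map_sup a b

theorem completion_smul_sup {r : ℝ} (hr : 0 ≤ r) (a b : Completion V) :
    r • (a ⊔ b) = r • a ⊔ r • b :=
  Completion.induction_on₂ a b
    (isClosed_eq ((continuous_fst.sup continuous_snd).const_smul r)
      ((continuous_fst.const_smul r).sup (continuous_snd.const_smul r))) fun a b => by
    simp only [← coe_sup, ← Completion.coe_smul, smul_sup_of_nonneg hr]

instance : PosSMulMono ℝ (Completion V) where
  smul_le_smul_of_nonneg_left r hr a b h := by
    rw [← sup_eq_right] at h ⊢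
    rw [← completion_smul_sup hr, h]

instance : PosSMulStrictMono ℝ (Completion V) := PosSMulMono.toPosSMulStrictMono

end HasSolidSeminorm

section Gauge

set_option linter.unusedSectionVars false

variable {X₁ : Type*} {X₂ : Type*} {Y : Type*}
  [NormedAddCommGroup X₁] [Lattice X₁] [IsOrderedAddMonoid X₁]
  [NormedSpace ℝ X₁] [PosSMulMono ℝ X₁]
  [NormedAddCommGroup X₂] [Lattice X₂] [IsOrderedAddMonoid X₂]
  [NormedSpace ℝ X₂] [PosSMulMono ℝ X₂]
  [AddCommGroup Y] [Lattice Y] [IsOrderedAddMonoid Y] [Module ℝ Y] [PosSMulMono ℝ Y]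

theorem abs_smul_le_smul_abs {W : Type*} [AddCommGroup W] [Lattice W] [IsOrderedAddMonoid W]
    [Module ℝ W] [PosSMulMono ℝ W] (r : ℝ) (w : W) : |r • w| ≤ |r| • |w| := by
  have key : ∀ s : ℝ, 0 ≤ s → ∀ v : W, |s • v| ≤ s • |v| := fun s hs v => by
    refine abs_le'.2 ⟨smul_le_smul_of_nonneg_left (le_abs_self v) hs, ?_⟩
    rw [← smul_neg]
    exact smul_le_smul_of_nonneg_left (neg_le_abs v) hs
  rcases le_total 0 r with hr | hr
  · rw [abs_of_nonneg hr]
    exact key r hr w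
  · rw [abs_of_nonpos hr, ← abs_neg, ← neg_smul]
    exact key (-r) (neg_nonneg.2 hr) w

/-- The pairs of positive elements whose combined image dominates `|y|`. -/
def majorants (R₁ : X₁ →ₗ[ℝ] Y) (R₂ : X₂ →ₗ[ℝ] Y) (y : Y) : Set (X₁ × X₂) :=
  {e | 0 ≤ e.1 ∧ 0 ≤ e.2 ∧ |y| ≤ R₁ e.1 + R₂ e.2}

theorem majorants_anti (R₁ : X₁ →ₗ[ℝ] Y) (R₂ : X₂ →ₗ[ℝ] Y) {x y : Y} (h : |x| ≤ |y|) :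
    majorants R₁ R₂ y ⊆ majorants R₁ R₂ x :=
  fun _ he => ⟨he.1, he.2.1, h.trans he.2.2⟩

theorem zero_mem_majorants (R₁ : X₁ →ₗ[ℝ] Y) (R₂ : X₂ →ₗ[ℝ] Y) :
    (0 : X₁ × X₂) ∈ majorants R₁ R₂ 0 := by
  simp [majorants]

theorem add_mem_majorants {R₁ : X₁ →ₗ[ℝ] Y} {R₂ : X₂ →ₗ[ℝ] Y} {x y : Y} {d e : X₁ × X₂}
    (hd : d ∈ majorants R₁ R₂ x) (he : e ∈ majorants R₁ R₂ y) :
    d + e ∈ majorants R₁ R₂ (x + y) := by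
  refine ⟨add_nonneg hd.1 he.1, add_nonneg hd.2.1 he.2.1, (abs_add_le x y).trans ?_⟩
  rw [Prod.fst_add, Prod.snd_add, map_add, map_add, add_add_add_comm]
  exact add_le_add hd.2.2 he.2.2

theorem smul_mem_majorants {R₁ : X₁ →ₗ[ℝ] Y} {R₂ : X₂ →ₗ[ℝ] Y} {y : Y} {e : X₁ × X₂}
    (r : ℝ) (he : e ∈ majorants R₁ R₂ y) : |r| • e ∈ majorants R₁ R₂ (r • y) := by
  refine ⟨smul_nonneg (abs_nonneg r) he.1, smul_nonneg (abs_nonneg r) he.2.1,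
    (abs_smul_le_smul_abs r y).trans ?_⟩
  rw [Prod.smul_fst, Prod.smul_snd, map_smul, map_smul, ← smul_add]
  exact smul_le_smul_of_nonneg_left he.2.2 (abs_nonneg r)

/-- The order ideal generated by the ranges of two positive maps. -/
def majorizedIdeal (R₁ : X₁ →ₗ[ℝ] Y) (R₂ : X₂ →ₗ[ℝ] Y) : Submodule ℝ Y where
  carrier := {y | (majorants R₁ R₂ y).Nonempty}
  zero_mem' := ⟨0, zero_mem_majorants R₁ R₂⟩
  add_mem' := fun ⟨_, hd⟩ ⟨_, he⟩ => ⟨_, add_mem_majorants hd he⟩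
  smul_mem' r _ := fun ⟨_, he⟩ => ⟨_, smul_mem_majorants r he⟩

theorem abs_sup_le_abs_add_abs (x y : Y) : |x ⊔ y| ≤ |(|x| + |y|)| := by
  rw [abs_of_nonneg (add_nonneg (abs_nonneg x) (abs_nonneg y))]
  refine abs_le'.2 ⟨sup_le ?_ ?_, ?_⟩
  · exact (le_abs_self x).trans (le_add_of_nonneg_right (abs_nonneg y))
  · exact (le_abs_self y).trans (le_add_of_nonneg_left (abs_nonneg x))
  · rw [neg_sup]
    exact inf_le_left.trans
      ((neg_le_abs x).trans (le_add_of_nonneg_right (abs_nonneg y)))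

theorem abs_mem_majorizedIdeal {R₁ : X₁ →ₗ[ℝ] Y} {R₂ : X₂ →ₗ[ℝ] Y} {x : Y}
    (hx : x ∈ majorizedIdeal R₁ R₂) : |x| ∈ majorizedIdeal R₁ R₂ :=
  hx.mono (majorants_anti R₁ R₂ (abs_abs x).le)

theorem sup_mem_majorizedIdeal {R₁ : X₁ →ₗ[ℝ] Y} {R₂ : X₂ →ₗ[ℝ] Y} {x y : Y}
    (hx : x ∈ majorizedIdeal R₁ R₂) (hy : y ∈ majorizedIdeal R₁ R₂) :
    x ⊔ y ∈ majorizedIdeal R₁ R₂ :=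
  ((majorizedIdeal R₁ R₂).add_mem (abs_mem_majorizedIdeal hx) (abs_mem_majorizedIdeal hy)).mono
    (majorants_anti R₁ R₂ (abs_sup_le_abs_add_abs x y))

theorem inf_mem_majorizedIdeal {R₁ : X₁ →ₗ[ℝ] Y} {R₂ : X₂ →ₗ[ℝ] Y} {x y : Y}
    (hx : x ∈ majorizedIdeal R₁ R₂) (hy : y ∈ majorizedIdeal R₁ R₂) :
    x ⊓ y ∈ majorizedIdeal R₁ R₂ := by
  have h := neg_mem (sup_mem_majorizedIdeal (neg_mem hx) (neg_mem hy))
  rwa [neg_sup, neg_neg, neg_neg] at h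

instance (R₁ : X₁ →ₗ[ℝ] Y) (R₂ : X₂ →ₗ[ℝ] Y) : Lattice (majorizedIdeal R₁ R₂) :=
  Subtype.lattice (fun _ _ hx hy => sup_mem_majorizedIdeal hx hy)
    (fun _ _ hx hy => inf_mem_majorizedIdeal hx hy)

instance (R₁ : X₁ →ₗ[ℝ] Y) (R₂ : X₂ →ₗ[ℝ] Y) :
    IsOrderedAddMonoid (majorizedIdeal R₁ R₂) where
  add_le_add_left a b h c := add_le_add_left (show (a : Y) ≤ b from h) (c : Y)

instance (R₁ : X₁ →ₗ[ℝ] Y) (R₂ : X₂ →ₗ[ℝ] Y) : PosSMulMono ℝ (majorizedIdeal R₁ R₂) where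
  smul_le_smul_of_nonneg_left _ hr a b h :=
    smul_le_smul_of_nonneg_left (α := ℝ) (β := Y) (show (a : Y) ≤ b from h) hr

/-- The infimum of `‖u‖ + ‖v‖` over all pairs `(u, v)` dominating `|y|`. -/
noncomputable def majorantGauge (R₁ : X₁ →ₗ[ℝ] Y) (R₂ : X₂ →ₗ[ℝ] Y) (y : Y) : ℝ :=
  sInf ((fun e : X₁ × X₂ => ‖e.1‖ + ‖e.2‖) '' majorants R₁ R₂ y)

theorem majorantGauge_le {R₁ : X₁ →ₗ[ℝ] Y} {R₂ : X₂ →ₗ[ℝ] Y} {y : Y} {e : X₁ × X₂}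
    (he : e ∈ majorants R₁ R₂ y) : majorantGauge R₁ R₂ y ≤ ‖e.1‖ + ‖e.2‖ := by
  refine csInf_le ⟨0, ?_⟩ ⟨e, he, rfl⟩
  rintro _ ⟨d, -, rfl⟩
  positivity

theorem le_majorantGauge {R₁ : X₁ →ₗ[ℝ] Y} {R₂ : X₂ →ₗ[ℝ] Y} {y : Y}
    (hy : y ∈ majorizedIdeal R₁ R₂) {t : ℝ}
    (h : ∀ e ∈ majorants R₁ R₂ y, t ≤ ‖e.1‖ + ‖e.2‖) : t ≤ majorantGauge R₁ R₂ y := by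
  refine le_csInf (Set.Nonempty.image _ hy) ?_
  rintro _ ⟨e, he, rfl⟩
  exact h e he

theorem majorantGauge_nonneg {R₁ : X₁ →ₗ[ℝ] Y} {R₂ : X₂ →ₗ[ℝ] Y} {y : Y}
    (hy : y ∈ majorizedIdeal R₁ R₂) : 0 ≤ majorantGauge R₁ R₂ y :=
  le_majorantGauge hy fun _ _ => by positivity

theorem majorantGauge_mono {R₁ : X₁ →ₗ[ℝ] Y} {R₂ : X₂ →ₗ[ℝ] Y} {x y : Y}
    (hy : y ∈ majorizedIdeal R₁ R₂) (h : |x| ≤ |y|) :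
    majorantGauge R₁ R₂ x ≤ majorantGauge R₁ R₂ y :=
  le_majorantGauge hy fun _ he => majorantGauge_le (majorants_anti R₁ R₂ h he)

theorem majorantGauge_add_le {R₁ : X₁ →ₗ[ℝ] Y} {R₂ : X₂ →ₗ[ℝ] Y} {x y : Y}
    (hx : x ∈ majorizedIdeal R₁ R₂) (hy : y ∈ majorizedIdeal R₁ R₂) :
    majorantGauge R₁ R₂ (x + y) ≤ majorantGauge R₁ R₂ x + majorantGauge R₁ R₂ y := by
  rw [← sub_le_iff_le_add]
  refine le_majorantGauge hx fun d hd => ?_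
  rw [sub_le_comm]
  refine le_majorantGauge hy fun e he => ?_
  have h := majorantGauge_le (add_mem_majorants hd he)
  rw [Prod.fst_add, Prod.snd_add] at h
  linarith [norm_add_le d.1 e.1, norm_add_le d.2 e.2]

theorem majorantGauge_smul_le {R₁ : X₁ →ₗ[ℝ] Y} {R₂ : X₂ →ₗ[ℝ] Y} {y : Y} (r : ℝ)
    (hy : y ∈ majorizedIdeal R₁ R₂) :
    majorantGauge R₁ R₂ (r • y) ≤ |r| * majorantGauge R₁ R₂ y := by
  rcases eq_or_ne r 0 with rfl | hr
  · simpa using majorantGauge_le (zero_mem_majorants R₁ R₂)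
  · have hr' : 0 < |r| := abs_pos.2 hr
    rw [← div_le_iff₀' hr']
    refine le_majorantGauge hy fun e he => ?_
    rw [div_le_iff₀' hr']
    have h := majorantGauge_le (smul_mem_majorants r he)
    rwa [Prod.smul_fst, Prod.smul_snd, norm_smul, norm_smul, Real.norm_eq_abs, abs_abs,
      ← mul_add] at h

noncomputable instance (R₁ : X₁ →ₗ[ℝ] Y) (R₂ : X₂ →ₗ[ℝ] Y) :
    SeminormedAddCommGroup (majorizedIdeal R₁ R₂) :=
  AddGroupSeminorm.toSeminormedAddCommGroup
    { toFun := fun y => majorantGauge R₁ R₂ (y : Y)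
      map_zero' := le_antisymm
        (by simpa using majorantGauge_le (zero_mem_majorants R₁ R₂))
        (majorantGauge_nonneg (majorizedIdeal R₁ R₂).zero_mem)
      add_le' := fun x y => majorantGauge_add_le x.2 y.2
      neg' := fun x => le_antisymm
        (majorantGauge_mono x.2 (abs_neg _).le)
        (majorantGauge_mono (-x).2 (abs_neg _).ge) }

theorem norm_majorizedIdeal (R₁ : X₁ →ₗ[ℝ] Y) (R₂ : X₂ →ₗ[ℝ] Y) (y : majorizedIdeal R₁ R₂) :
    ‖y‖ = majorantGauge R₁ R₂ (y : Y) := rfl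

noncomputable instance (R₁ : X₁ →ₗ[ℝ] Y) (R₂ : X₂ →ₗ[ℝ] Y) :
    NormedSpace ℝ (majorizedIdeal R₁ R₂) where
  norm_smul_le r y := majorantGauge_smul_le r y.2

instance (R₁ : X₁ →ₗ[ℝ] Y) (R₂ : X₂ →ₗ[ℝ] Y) : HasSolidSeminorm (majorizedIdeal R₁ R₂) where
  solid _ y h := majorantGauge_mono y.2 h

theorem map_abs_of_map_sup {W : Type*} [AddCommGroup W] [Lattice W] [Module ℝ W]
    {R : W →ₗ[ℝ] Y} (h : ∀ x y, R (x ⊔ y) = R x ⊔ R y) (x : W) : R |x| = |R x| := by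
  rw [abs, abs, h, map_neg]

/-- Two lattice homomorphisms into a common vector lattice for which domination by
`R₁ u + R₂ v` reflects norm inequalities factor isometrically through a Banach lattice. -/
theorem exists_isometric_factorization {X₁ : Type v} {X₂ : Type w} {Y : Type u}
    [NormedAddCommGroup X₁] [Lattice X₁] [HasSolidNorm X₁] [IsOrderedAddMonoid X₁]
    [NormedSpace ℝ X₁] [PosSMulMono ℝ X₁]
    [NormedAddCommGroup X₂] [Lattice X₂] [HasSolidNorm X₂] [IsOrderedAddMonoid X₂]
    [NormedSpace ℝ X₂] [PosSMulMono ℝ X₂]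
    [AddCommGroup Y] [Lattice Y] [IsOrderedAddMonoid Y] [Module ℝ Y] [PosSMulMono ℝ Y]
    (R₁ : X₁ →ₗ[ℝ] Y) (R₂ : X₂ →ₗ[ℝ] Y)
    (hR₁ : ∀ x y, R₁ (x ⊔ y) = R₁ x ⊔ R₁ y) (hR₂ : ∀ x y, R₂ (x ⊔ y) = R₂ x ⊔ R₂ y)
    (h₁ : ∀ x u v, 0 ≤ x → 0 ≤ u → 0 ≤ v → R₁ x ≤ R₁ u + R₂ v → ‖x‖ ≤ ‖u‖ + ‖v‖)
    (h₂ : ∀ x u v, 0 ≤ x → 0 ≤ u → 0 ≤ v → R₂ x ≤ R₁ u + R₂ v → ‖x‖ ≤ ‖u‖ + ‖v‖) :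
    ∃ (X₃ : Type u) (_ : NormedAddCommGroup X₃) (_ : Lattice X₃)
      (_ : HasSolidNorm X₃) (_ : IsOrderedAddMonoid X₃) (_ : NormedSpace ℝ X₃)
      (_ : PosSMulStrictMono ℝ X₃) (_ : PosSMulReflectLT ℝ X₃) (_ : CompleteSpace X₃)
      (S₁ : X₁ →ₗ[ℝ] X₃) (S₂ : X₂ →ₗ[ℝ] X₃),
      (∀ x y : X₁, S₁ (x ⊔ y) = S₁ x ⊔ S₁ y) ∧ (∀ x : X₁, ‖S₁ x‖ = ‖x‖) ∧
      (∀ x y : X₂, S₂ (x ⊔ y) = S₂ x ⊔ S₂ y) ∧ (∀ x : X₂, ‖S₂ x‖ = ‖x‖) ∧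
      (∀ x y, R₁ x = R₂ y → S₁ x = S₂ y) := by
  have m₁ : ∀ x, (|x|, 0) ∈ majorants R₁ R₂ (R₁ x) := fun x =>
    ⟨abs_nonneg x, le_rfl, by simp [map_abs_of_map_sup hR₁]⟩
  have m₂ : ∀ x, (0, |x|) ∈ majorants R₁ R₂ (R₂ x) := fun x =>
    ⟨le_rfl, abs_nonneg x, by simp [map_abs_of_map_sup hR₂]⟩
  let J₁ : X₁ →ₗ[ℝ] majorizedIdeal R₁ R₂ := R₁.codRestrict _ fun x => ⟨_, m₁ x⟩
  let J₂ : X₂ →ₗ[ℝ] majorizedIdeal R₁ R₂ := R₂.codRestrict _ fun x => ⟨_, m₂ x⟩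
  let ι : majorizedIdeal R₁ R₂ →ₗ[ℝ] UniformSpace.Completion (majorizedIdeal R₁ R₂) :=
    UniformSpace.Completion.toComplₗᵢ.toLinearMap
  have hι : ∀ x y, ι (x ⊔ y) = ι x ⊔ ι y := HasSolidSeminorm.coe_sup
  have hιn : ∀ x, ‖ι x‖ = ‖x‖ := UniformSpace.Completion.norm_coe
  refine ⟨UniformSpace.Completion (majorizedIdeal R₁ R₂), inferInstance, inferInstance,
    inferInstance, inferInstance, inferInstance, inferInstance, inferInstance, inferInstance,
    ι ∘ₗ J₁, ι ∘ₗ J₂, fun x y => ?_, fun x => ?_, fun x y => ?_, fun x => ?_, fun x y h => ?_⟩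
  · rw [LinearMap.comp_apply, LinearMap.comp_apply, LinearMap.comp_apply, ← hι]
    exact congrArg ι (Subtype.ext (hR₁ x y))
  · rw [LinearMap.comp_apply, hιn, norm_majorizedIdeal]
    refine le_antisymm ?_ (le_majorantGauge (J₁ x).2 fun e he => ?_)
    · have h := majorantGauge_le (m₁ x)
      simp only [norm_abs_eq_norm, norm_zero, add_zero] at h
      exact h
    · rw [← norm_abs_eq_norm x]
      refine h₁ _ _ _ (abs_nonneg x) he.1 he.2.1 ?_
      rw [map_abs_of_map_sup hR₁]
      exact he.2.2
  · rw [LinearMap.comp_apply, LinearMap.comp_apply, LinearMap.comp_apply, ← hι]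
    exact congrArg ι (Subtype.ext (hR₂ x y))
  · rw [LinearMap.comp_apply, hιn, norm_majorizedIdeal]
    refine le_antisymm ?_ (le_majorantGauge (J₂ x).2 fun e he => ?_)
    · have h := majorantGauge_le (m₂ x)
      simp only [norm_abs_eq_norm, norm_zero, zero_add] at h
      exact h
    · rw [← norm_abs_eq_norm x]
      refine h₂ _ _ _ (abs_nonneg x) he.1 he.2.1 ?_
      rw [map_abs_of_map_sup hR₂]
      exact he.2.2
  · exact congrArg ι (Subtype.ext h)

end Gauge

namespace PointedCone

variable {E : Type*} [AddCommGroup E] [Module ℝ E]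

theorem real_smul_mem (Q : PointedCone ℝ E) {r : ℝ} (hr : 0 ≤ r) {x : E} (hx : x ∈ Q) :
    r • x ∈ Q :=
  Submodule.smul_mem Q (⟨r, hr⟩ : {c : ℝ // 0 ≤ c}) hx

theorem exists_add_smul_of_mem_sup_span {Q : PointedCone ℝ E} {d x : E}
    (h : x ∈ Q ⊔ Submodule.span {c : ℝ // 0 ≤ c} {d}) :
    ∃ q ∈ Q, ∃ r : ℝ, 0 ≤ r ∧ x = q + r • d := by
  obtain ⟨q, hq, y, hy, rfl⟩ := Submodule.mem_sup.1 h
  obtain ⟨r, rfl⟩ := Submodule.mem_span_singleton.1 hy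
  exact ⟨q, hq, r, r.2, rfl⟩

/-- A maximal cone avoiding a given vector is total. -/
theorem exists_total_of_notMem (P : PointedCone ℝ E) {c : E} (hc : c ∉ P) :
    ∃ Q : PointedCone ℝ E, P ≤ Q ∧ c ∉ Q ∧ ∀ x, x ∈ Q ∨ -x ∈ Q := by
  obtain ⟨Q, hPQ, hQ⟩ := zorn_le_nonempty₀ {Q : PointedCone ℝ E | c ∉ Q}
    (fun S hS hch Q hQS => ⟨sSup S, fun h => by
      obtain ⟨M, hM, hcM⟩ := (Submodule.mem_sSup_of_directed ⟨Q, hQS⟩ hch.directedOn).1 h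
      exact hS hM hcM, fun M hM => le_sSup hM⟩) P hc
  have key : ∀ x, x ∉ Q → ∃ q ∈ Q, ∃ r : ℝ, 0 < r ∧ c = q + r • x := fun x hx => by
    have hcx : c ∈ Q ⊔ Submodule.span {c : ℝ // 0 ≤ c} {x} := by
      by_contra h
      exact hx (hQ.2 h le_sup_left
        (Submodule.mem_sup_right (Submodule.mem_span_singleton_self x)))
    obtain ⟨q, hq, r, hr, h⟩ := exists_add_smul_of_mem_sup_span hcx
    refine ⟨q, hq, r, hr.lt_of_ne ?_, h⟩
    rintro rfl
    rw [zero_smul, add_zero] at h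
    exact hQ.1 (h ▸ hq)
  refine ⟨Q, hPQ, hQ.1, fun x => ?_⟩
  by_contra! hx
  obtain ⟨q, hq, r, hr, h⟩ := key x hx.1
  obtain ⟨q', hq', s, hs, h'⟩ := key (-x) hx.2
  refine hQ.1 ?_
  have hsum : c = (r + s)⁻¹ • (s • q + r • q') := by
    rw [eq_inv_smul_iff₀ (by positivity), add_smul]
    nth_rewrite 1 [h']
    rw [h]
    module
  rw [hsum]
  exact Q.real_smul_mem (by positivity)
    (add_mem (Q.real_smul_mem hs.le hq) (Q.real_smul_mem hr.le hq'))

/-- The subspace of vectors lying in a cone together with their negatives. -/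
def nullSubspace (Q : PointedCone ℝ E) : Submodule ℝ E where
  carrier := {x | x ∈ Q ∧ -x ∈ Q}
  zero_mem' := by simp
  add_mem' := fun {x y} hx hy => ⟨add_mem hx.1 hy.1, by
    rw [neg_add]
    exact add_mem hx.2 hy.2⟩
  smul_mem' := fun r x hx => by
    rcases le_total 0 r with hr | hr
    · refine ⟨Q.real_smul_mem hr hx.1, ?_⟩
      rw [← smul_neg]
      exact Q.real_smul_mem hr hx.2
    · have hr' : 0 ≤ -r := neg_nonneg.2 hr
      refine ⟨?_, ?_⟩
      · rw [← neg_smul_neg]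
        exact Q.real_smul_mem hr' hx.2
      · rw [← neg_smul]
        exact Q.real_smul_mem hr' hx.1

/-- The image of a cone in the quotient by its null subspace. -/
def quotientCone (Q : PointedCone ℝ E) : AddGroupCone (E ⧸ Q.nullSubspace) where
  __ := Q.toAddSubmonoid.map Q.nullSubspace.mkQ
  eq_zero_of_mem_of_neg_mem' := by
    rintro _ ⟨x, hx, rfl⟩ ⟨y, hy, h⟩
    have hxy : x + y ∈ Q.nullSubspace := by
      rw [← Submodule.Quotient.mk_eq_zero, Submodule.Quotient.mk_add]
      exact add_eq_zero_iff_eq_neg'.2 h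
    refine (Submodule.Quotient.mk_eq_zero _).2 ⟨hx, ?_⟩
    have : -x = y + -(x + y) := by abel
    rw [this]
    exact add_mem hy hxy.2

theorem mk_mem_quotientCone (Q : PointedCone ℝ E) (x : E) :
    (Submodule.Quotient.mk x : E ⧸ Q.nullSubspace) ∈ Q.quotientCone ↔ x ∈ Q := by
  refine ⟨?_, fun hx => ⟨x, hx, rfl⟩⟩
  rintro ⟨y, hy, h⟩
  have hyx : y - x ∈ Q.nullSubspace := (Submodule.Quotient.eq _).1 h
  have : x = y + -(y - x) := by abel
  rw [this]
  exact add_mem hy hyx.2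

end PointedCone

section AmalgamCone

set_option linter.unusedSectionVars false

variable {X₀ : Type*} {X₁ : Type*} {X₂ : Type*}
  [AddCommGroup X₀] [Lattice X₀] [IsOrderedAddMonoid X₀] [Module ℝ X₀]
  [AddCommGroup X₁] [Lattice X₁] [IsOrderedAddMonoid X₁] [Module ℝ X₁] [PosSMulMono ℝ X₁]
  [AddCommGroup X₂] [Lattice X₂] [IsOrderedAddMonoid X₂] [Module ℝ X₂] [PosSMulMono ℝ X₂]

/-- A total vector preorder on `X₁ × X₂` that identifies the two images of `X₀` and whose
restrictions to both factors are lattice preorders. -/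
structure AmalgamCone (T₁ : X₀ →ₗ[ℝ] X₁) (T₂ : X₀ →ₗ[ℝ] X₂) where
  /-- The cone of nonnegative elements. -/
  cone : PointedCone ℝ (X₁ × X₂)
  total : ∀ x, x ∈ cone ∨ -x ∈ cone
  nonneg_mem : ∀ x, 0 ≤ x → x ∈ cone
  rel_mem : ∀ w, (T₁ w, -T₂ w) ∈ cone
  prime_fst : ∀ x : X₁, -(x⁺, 0) ∈ cone ∨ -(x⁻, 0) ∈ cone
  prime_snd : ∀ x : X₂, -(0, x⁺) ∈ cone ∨ -(0, x⁻) ∈ cone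

namespace AmalgamCone

variable {T₁ : X₀ →ₗ[ℝ] X₁} {T₂ : X₀ →ₗ[ℝ] X₂}

theorem le_zero_of_le_smul_posPart_of_le_smul_negPart {W : Type*} [AddCommGroup W] [Lattice W]
    [IsOrderedAddMonoid W] [Module ℝ W] [PosSMulMono ℝ W] {x y : W} {r s : ℝ}
    (hr : 0 ≤ r) (hs : 0 ≤ s) (h₁ : y ≤ r • x⁺) (h₂ : y ≤ s • x⁻) : y ≤ 0 := by
  have hrs : 0 < r + s + 1 := by positivity
  have e₁ : r • x⁺ ≤ (r + s + 1) • x⁺ := by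
    rw [add_assoc, add_smul]
    exact le_add_of_nonneg_right (smul_nonneg (by positivity) (posPart_nonneg x))
  have e₂ : s • x⁻ ≤ (r + s + 1) • x⁻ := by
    rw [add_right_comm, add_smul]
    exact le_add_of_nonneg_left (smul_nonneg (by positivity) (negPart_nonneg x))
  calc y ≤ (r + s + 1) • x⁺ ⊓ (r + s + 1) • x⁻ := le_inf (h₁.trans e₁) (h₂.trans e₂)
    _ = (r + s + 1) • (x⁺ ⊓ x⁻) := ((OrderIso.smulRight hrs).map_inf _ _).symm
    _ = 0 := by rw [posPart_inf_negPart_eq_zero, smul_zero]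

/-- If no element of `X₀` interpolates, there is a cone of positive vectors to be annihilated that
contains one of any two complementary parts and still admits no interpolation. -/
theorem exists_prime_cone (hT₁ : ∀ x y, T₁ (x ⊔ y) = T₁ x ⊔ T₁ y)
    (hT₂ : ∀ x y, T₂ (x ⊔ y) = T₂ x ⊔ T₂ y) {c : X₁ × X₂}
    (hc : ¬∃ w, 0 ≤ c + (T₁ w, -T₂ w)) :
    ∃ N : PointedCone ℝ (X₁ × X₂), (¬∃ w, ∃ n ∈ N, 0 ≤ c + (T₁ w, -T₂ w) + n) ∧
      (∀ x : X₁, (x⁺, 0) ∈ N ∨ (x⁻, 0) ∈ N) ∧ (∀ x : X₂, (0, x⁺) ∈ N ∨ (0, x⁻) ∈ N) := by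
  obtain ⟨N, -, hN⟩ := zorn_le_nonempty₀ {N : PointedCone ℝ (X₁ × X₂) |
      (∀ n ∈ N, 0 ≤ n) ∧ ¬∃ w, ∃ n ∈ N, 0 ≤ c + (T₁ w, -T₂ w) + n}
    (fun S hS hch M hMS => by
      have hmem : ∀ n, n ∈ sSup S ↔ ∃ M ∈ S, n ∈ M := fun n =>
        Submodule.mem_sSup_of_directed ⟨M, hMS⟩ hch.directedOn
      refine ⟨sSup S, ⟨fun n hn => ?_, ?_⟩, fun M hM => le_sSup hM⟩
      · obtain ⟨M, hM, hn⟩ := (hmem n).1 hn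
        exact (hS hM).1 n hn
      · rintro ⟨w, n, hn, h⟩
        obtain ⟨M, hM, hn⟩ := (hmem n).1 hn
        exact (hS hM).2 ⟨w, n, hn, h⟩) ⊥
    ⟨fun n hn => ((Submodule.mem_bot _).1 hn).ge, by
      rintro ⟨w, n, hn, h⟩
      rw [(Submodule.mem_bot _).1 hn, add_zero] at h
      exact hc ⟨w, h⟩⟩
  have key : ∀ d, 0 ≤ d → d ∉ N →
      ∃ w, ∃ n ∈ N, ∃ r : ℝ, 0 ≤ r ∧ 0 ≤ c + (T₁ w, -T₂ w) + (n + r • d) := fun d hd hdN => by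
    by_contra h
    refine hdN (hN.2 ⟨fun n hn => ?_, ?_⟩ le_sup_left
      (Submodule.mem_sup_right (Submodule.mem_span_singleton_self d)))
    · obtain ⟨q, hq, r, hr, rfl⟩ := PointedCone.exists_add_smul_of_mem_sup_span hn
      exact add_nonneg (hN.1.1 q hq) (smul_nonneg hr hd)
    · rintro ⟨w, n, hn, hw⟩
      obtain ⟨q, hq, r, hr, rfl⟩ := PointedCone.exists_add_smul_of_mem_sup_span hn
      exact h ⟨w, q, hq, r, hr, hw⟩
  have mono₁ : Monotone T₁ := fun x y h => by
    rw [← sup_eq_right, ← hT₁, sup_eq_right.2 h]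
  have mono₂ : Monotone T₂ := fun x y h => by
    rw [← sup_eq_right, ← hT₂, sup_eq_right.2 h]
  have inf₁ : ∀ x y, T₁ (x ⊓ y) = T₁ x ⊓ T₁ y := fun x y => by
    rw [← neg_inj, ← map_neg, neg_inf, hT₁, map_neg, map_neg, neg_inf]
  refine ⟨N, hN.1.2, fun x => ?_, fun x => ?_⟩
  · by_contra! hx
    obtain ⟨w, n, hn, r, hr, h⟩ := key (x⁺, 0) ⟨posPart_nonneg x, le_rfl⟩ hx.1
    obtain ⟨w', n', hn', r', hr', h'⟩ := key (x⁻, 0) ⟨negPart_nonneg x, le_rfl⟩ hx.2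
    have pn := hN.1.1 n hn
    have pn' := hN.1.1 n' hn'
    refine hN.1.2 ⟨w ⊔ w', n + n', add_mem hn hn', ?_, ?_⟩
    · have a₁ : 0 ≤ c.1 + T₁ w + (n.1 + r • x⁺) := h.1
      have a₂ : 0 ≤ c.1 + T₁ w' + (n'.1 + r' • x⁻) := h'.1
      have b₁ : T₁ w ≤ T₁ (w ⊔ w') := mono₁ le_sup_left
      have b₂ : T₁ w' ≤ T₁ (w ⊔ w') := mono₁ le_sup_right
      have p : 0 ≤ n.1 := pn.1
      have p' : 0 ≤ n'.1 := pn'.1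
      refine neg_nonpos.1 (le_zero_of_le_smul_posPart_of_le_smul_negPart (x := x) hr hr' ?_ ?_)
      · rw [← sub_nonneg]
        refine (add_nonneg a₁ (add_nonneg (sub_nonneg.2 b₁) p')).trans_eq ?_
        simp only [Prod.fst_add]
        abel
      · rw [← sub_nonneg]
        refine (add_nonneg a₂ (add_nonneg (sub_nonneg.2 b₂) p)).trans_eq ?_
        simp only [Prod.fst_add]
        abel
    · have a₁ : 0 ≤ c.2 + -T₂ w + (n.2 + r • 0) := h.2
      have a₂ : 0 ≤ c.2 + -T₂ w' + (n'.2 + r' • 0) := h'.2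
      rw [smul_zero] at a₁ a₂
      have p : 0 ≤ n.2 := pn.2
      have p' : 0 ≤ n'.2 := pn'.2
      have hsup : T₂ (w ⊔ w') ≤ c.2 + (n.2 + n'.2) := by
        rw [hT₂]
        refine sup_le (sub_nonneg.1 ?_) (sub_nonneg.1 ?_)
        · exact (add_nonneg a₁ p').trans_eq (by abel)
        · exact (add_nonneg a₂ p).trans_eq (by abel)
      refine (sub_nonneg.2 hsup).trans_eq ?_
      simp only [Prod.snd_add]
      abel
  · by_contra! hx
    obtain ⟨w, n, hn, r, hr, h⟩ := key (0, x⁺) ⟨le_rfl, posPart_nonneg x⟩ hx.1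
    obtain ⟨w', n', hn', r', hr', h'⟩ := key (0, x⁻) ⟨le_rfl, negPart_nonneg x⟩ hx.2
    have pn := hN.1.1 n hn
    have pn' := hN.1.1 n' hn'
    refine hN.1.2 ⟨w ⊓ w', n + n', add_mem hn hn', ?_, ?_⟩
    · have a₁ : 0 ≤ c.1 + T₁ w + (n.1 + r • 0) := h.1
      have a₂ : 0 ≤ c.1 + T₁ w' + (n'.1 + r' • 0) := h'.1
      rw [smul_zero] at a₁ a₂
      have p : 0 ≤ n.1 := pn.1
      have p' : 0 ≤ n'.1 := pn'.1
      have hinf : -(c.1 + (n.1 + n'.1)) ≤ T₁ (w ⊓ w') := by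
        rw [inf₁]
        refine le_inf (sub_nonneg.1 ?_) (sub_nonneg.1 ?_)
        · exact (add_nonneg a₁ p').trans_eq (by abel)
        · exact (add_nonneg a₂ p).trans_eq (by abel)
      refine (sub_nonneg.2 hinf).trans_eq ?_
      simp only [Prod.fst_add]
      abel
    · have a₁ : 0 ≤ c.2 + -T₂ w + (n.2 + r • x⁺) := h.2
      have a₂ : 0 ≤ c.2 + -T₂ w' + (n'.2 + r' • x⁻) := h'.2
      have b₁ : T₂ (w ⊓ w') ≤ T₂ w := mono₂ inf_le_left
      have b₂ : T₂ (w ⊓ w') ≤ T₂ w' := mono₂ inf_le_right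
      have p : 0 ≤ n.2 := pn.2
      have p' : 0 ≤ n'.2 := pn'.2
      refine neg_nonpos.1 (le_zero_of_le_smul_posPart_of_le_smul_negPart (x := x) hr hr' ?_ ?_)
      · rw [← sub_nonneg]
        refine (add_nonneg a₁ (add_nonneg (sub_nonneg.2 b₁) p')).trans_eq ?_
        simp only [Prod.snd_add]
        abel
      · rw [← sub_nonneg]
        refine (add_nonneg a₂ (add_nonneg (sub_nonneg.2 b₂) p)).trans_eq ?_
        simp only [Prod.snd_add]
        abel

theorem exists_interpolant (hT₁ : ∀ x y, T₁ (x ⊔ y) = T₁ x ⊔ T₁ y)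
    (hT₂ : ∀ x y, T₂ (x ⊔ y) = T₂ x ⊔ T₂ y) {c : X₁ × X₂}
    (hc : ∀ C : AmalgamCone T₁ T₂, c ∈ C.cone) : ∃ w, 0 ≤ c + (T₁ w, -T₂ w) := by
  by_contra h
  obtain ⟨N, hN, hfst, hsnd⟩ := exists_prime_cone hT₁ hT₂ h
  let P : PointedCone ℝ (X₁ × X₂) :=
    { carrier := {x | ∃ w, ∃ n ∈ N, 0 ≤ x + (T₁ w, -T₂ w) + n}
      zero_mem' := ⟨0, 0, zero_mem N, by simp [← Prod.zero_eq_mk]⟩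
      add_mem' := by
        rintro x y ⟨w, n, hn, hx⟩ ⟨w', n', hn', hy⟩
        refine ⟨w + w', n + n', add_mem hn hn', (add_nonneg hx hy).trans_eq ?_⟩
        rw [map_add, map_add, neg_add, ← Prod.mk_add_mk]
        abel
      smul_mem' := by
        rintro ⟨r, hr⟩ x ⟨w, n, hn, hx⟩
        refine ⟨r • w, r • n, N.real_smul_mem hr hn, (smul_nonneg hr hx).trans_eq ?_⟩
        rw [map_smul, map_smul, ← smul_neg, ← Prod.smul_mk, smul_add, smul_add]
        rfl }
  have neg_mem_P : ∀ n ∈ N, -n ∈ P := fun n hn => ⟨0, n, hn, by simp [← Prod.zero_eq_mk]⟩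
  obtain ⟨Q, hPQ, hcQ, htot⟩ := P.exists_total_of_notMem (c := c) hN
  exact hcQ (hc
    { cone := Q
      total := htot
      nonneg_mem := fun x hx => hPQ ⟨0, 0, zero_mem N, by simpa [← Prod.zero_eq_mk] using hx⟩
      rel_mem := fun w => hPQ ⟨-w, 0, zero_mem N, by simp [← Prod.zero_eq_mk]⟩
      prime_fst := fun x => (hfst x).imp (fun hx => hPQ (neg_mem_P _ hx))
        (fun hx => hPQ (neg_mem_P _ hx))
      prime_snd := fun x => (hsnd x).imp (fun hx => hPQ (neg_mem_P _ hx))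
        (fun hx => hPQ (neg_mem_P _ hx)) })

/-- The totally ordered quotient defined by an amalgamating cone. -/
abbrev Fiber (C : AmalgamCone T₁ T₂) : Type _ := (X₁ × X₂) ⧸ C.cone.nullSubspace

noncomputable instance (C : AmalgamCone T₁ T₂) : LinearOrder C.Fiber :=
  haveI : HasMemOrNegMem C.cone.quotientCone := ⟨fun q => by
    induction q using Submodule.Quotient.induction_on with
    | _ x =>
      rw [← Submodule.Quotient.mk_neg, PointedCone.mk_mem_quotientCone,
        PointedCone.mk_mem_quotientCone]
      exact C.total x⟩
  letI : DecidablePred (· ∈ C.cone.quotientCone) := Classical.decPred _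
  LinearOrder.mkOfAddGroupCone C.cone.quotientCone

instance (C : AmalgamCone T₁ T₂) : IsOrderedAddMonoid C.Fiber :=
  IsOrderedAddMonoid.mkOfCone C.cone.quotientCone

theorem mkQ_nonneg_iff (C : AmalgamCone T₁ T₂) (x : X₁ × X₂) :
    0 ≤ C.cone.nullSubspace.mkQ x ↔ x ∈ C.cone := by
  rw [← C.cone.mk_mem_quotientCone x]
  change C.cone.nullSubspace.mkQ x - 0 ∈ C.cone.quotientCone ↔ _
  rw [sub_zero]
  rfl

instance (C : AmalgamCone T₁ T₂) : PosSMulMono ℝ C.Fiber :=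
  PosSMulMono.of_smul_nonneg fun r hr q hq => by
    induction q using Submodule.Quotient.induction_on with
    | _ x =>
      exact (C.mkQ_nonneg_iff (r • x)).2 (C.cone.real_smul_mem hr ((C.mkQ_nonneg_iff x).1 hq))

theorem map_sup_of_prime {X Y : Type*} [AddCommGroup X] [Lattice X] [IsOrderedAddMonoid X]
    [Module ℝ X] [AddCommGroup Y] [LinearOrder Y] [IsOrderedAddMonoid Y] [Module ℝ Y]
    (R : X →ₗ[ℝ] Y) (hR : ∀ x, 0 ≤ x → 0 ≤ R x) (h : ∀ x, R x⁺ ≤ 0 ∨ R x⁻ ≤ 0) (x y : X) :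
    R (x ⊔ y) = R x ⊔ R y := by
  have hsub : R (x - y)⁺ - R (x - y)⁻ = R x - R y := by
    rw [← map_sub, posPart_sub_negPart, map_sub]
  have hsup : R (x ⊔ y) = R (x - y)⁺ + R y := by
    rw [← map_add, posPart_def, sup_add, sub_add_cancel, zero_add]
  have hp := hR _ (posPart_nonneg (x - y))
  have hn := hR _ (negPart_nonneg (x - y))
  rcases h (x - y) with h | h
  · rw [h.antisymm hp, zero_sub] at hsub
    rw [hsup, h.antisymm hp, zero_add, sup_eq_right.2]
    rw [← sub_nonpos, ← hsub]
    exact neg_nonpos.2 hn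
  · rw [h.antisymm hn, sub_zero] at hsub
    rw [hsup, hsub, sub_add_cancel, sup_eq_left.2]
    rw [← sub_nonneg, ← hsub]
    exact hp

theorem mkQ_inl_sup (C : AmalgamCone T₁ T₂) (x y : X₁) :
    C.cone.nullSubspace.mkQ (x ⊔ y, 0) =
      C.cone.nullSubspace.mkQ (x, 0) ⊔ C.cone.nullSubspace.mkQ (y, 0) :=
  map_sup_of_prime (C.cone.nullSubspace.mkQ ∘ₗ LinearMap.inl ℝ X₁ X₂)
    (fun x hx => (C.mkQ_nonneg_iff _).2 (C.nonneg_mem (x, 0) ⟨hx, le_rfl⟩))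
    (fun x => (C.prime_fst x).imp
      (fun h => neg_nonneg.1 ((C.mkQ_nonneg_iff _).2 h))
      (fun h => neg_nonneg.1 ((C.mkQ_nonneg_iff _).2 h))) x y

theorem mkQ_inr_sup (C : AmalgamCone T₁ T₂) (x y : X₂) :
    C.cone.nullSubspace.mkQ (0, x ⊔ y) =
      C.cone.nullSubspace.mkQ (0, x) ⊔ C.cone.nullSubspace.mkQ (0, y) :=
  map_sup_of_prime (C.cone.nullSubspace.mkQ ∘ₗ LinearMap.inr ℝ X₁ X₂)
    (fun x hx => (C.mkQ_nonneg_iff _).2 (C.nonneg_mem (0, x) ⟨le_rfl, hx⟩))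
    (fun x => (C.prime_snd x).imp
      (fun h => neg_nonneg.1 ((C.mkQ_nonneg_iff _).2 h))
      (fun h => neg_nonneg.1 ((C.mkQ_nonneg_iff _).2 h))) x y

theorem mkQ_rel (C : AmalgamCone T₁ T₂) (w : X₀) :
    C.cone.nullSubspace.mkQ (T₁ w, 0) = C.cone.nullSubspace.mkQ (0, T₂ w) := by
  rw [← sub_eq_zero, ← map_sub, Prod.mk_sub_mk, sub_zero, zero_sub]
  refine (Submodule.Quotient.mk_eq_zero _).2 ⟨C.rel_mem w, ?_⟩
  simpa using C.rel_mem (-w)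

end AmalgamCone

end AmalgamCone

/-- Domination transfers along an element of the common sublattice without loss of norm. -/
theorem norm_le_add_norm_of_interpolant {X Z W : Type*}
    [NormedAddCommGroup X] [Lattice X] [NormedSpace ℝ X]
    [NormedAddCommGroup Z] [Lattice Z] [HasSolidNorm Z] [IsOrderedAddMonoid Z] [NormedSpace ℝ Z]
    [NormedAddCommGroup W] [Lattice W] [HasSolidNorm W] [IsOrderedAddMonoid W] [NormedSpace ℝ W]
    {T : X →ₗ[ℝ] Z} {T' : X →ₗ[ℝ] W} (hT : ∀ x y, T (x ⊔ y) = T x ⊔ T y)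
    (hT' : ∀ x y, T' (x ⊔ y) = T' x ⊔ T' y) (hTn : ∀ x, ‖T x‖ = ‖x‖) (hTn' : ∀ x, ‖T' x‖ = ‖x‖)
    {x u : Z} {v : W} {w : X} (hx : 0 ≤ x) (hv : 0 ≤ v) (h : x ≤ u + T w) (h' : T' w ≤ v) :
    ‖x‖ ≤ ‖u‖ + ‖v‖ := by
  have hw : T w ≤ T (w ⊔ 0) := by
    rw [hT]
    exact le_sup_left
  have hxu : x ≤ u + T (w ⊔ 0) := h.trans (add_le_add_right hw u)
  have hnx : ‖x‖ ≤ ‖u + T (w ⊔ 0)‖ := norm_le_norm_of_abs_le_abs (by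
    rwa [abs_of_nonneg hx, abs_of_nonneg (hx.trans hxu)])
  have hnv : ‖T' (w ⊔ 0)‖ ≤ ‖v‖ := norm_le_norm_of_abs_le_abs (by
    rw [hT', map_zero, abs_of_nonneg le_sup_right, abs_of_nonneg hv]
    exact sup_le h' hv)
  rw [hTn'] at hnv
  have := norm_add_le u (T (w ⊔ 0))
  rw [hTn] at this
  linarith

/-- Amalgamation of Banach lattices: given isometric lattice embeddings
`T₁ : X₀ → X₁` and `T₂ : X₀ → X₂` between real Banach lattices, there exist a Banach
lattice `X₃` and isometric lattice embeddings `S₁ : X₁ → X₃`, `S₂ : X₂ → X₃` with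
`S₁ ∘ T₁ = S₂ ∘ T₂`. -/
theorem banach_lattice_amalgamation {X₀ : Type u} {X₁ : Type v} {X₂ : Type w}
    [NormedAddCommGroup X₀] [Lattice X₀] [HasSolidNorm X₀] [IsOrderedAddMonoid X₀]
    [NormedSpace ℝ X₀] [PosSMulStrictMono ℝ X₀] [PosSMulReflectLT ℝ X₀] [CompleteSpace X₀]
    [NormedAddCommGroup X₁] [Lattice X₁] [HasSolidNorm X₁] [IsOrderedAddMonoid X₁]
    [NormedSpace ℝ X₁] [PosSMulStrictMono ℝ X₁] [PosSMulReflectLT ℝ X₁] [CompleteSpace X₁]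
    [NormedAddCommGroup X₂] [Lattice X₂] [HasSolidNorm X₂] [IsOrderedAddMonoid X₂]
    [NormedSpace ℝ X₂] [PosSMulStrictMono ℝ X₂] [PosSMulReflectLT ℝ X₂] [CompleteSpace X₂]
    (T₁ : X₀ →ₗ[ℝ] X₁) (T₂ : X₀ →ₗ[ℝ] X₂)
    (hT₁sup : ∀ x y : X₀, T₁ (x ⊔ y) = T₁ x ⊔ T₁ y) (hT₁iso : ∀ x : X₀, ‖T₁ x‖ = ‖x‖)
    (hT₂sup : ∀ x y : X₀, T₂ (x ⊔ y) = T₂ x ⊔ T₂ y) (hT₂iso : ∀ x : X₀, ‖T₂ x‖ = ‖x‖) :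
    ∃ (X₃ : Type (max u v w)) (_ : NormedAddCommGroup X₃) (_ : Lattice X₃)
      (_ : HasSolidNorm X₃) (_ : IsOrderedAddMonoid X₃) (_ : NormedSpace ℝ X₃)
      (_ : PosSMulStrictMono ℝ X₃) (_ : PosSMulReflectLT ℝ X₃) (_ : CompleteSpace X₃)
      (S₁ : X₁ →ₗ[ℝ] X₃) (S₂ : X₂ →ₗ[ℝ] X₃),
      (∀ x y : X₁, S₁ (x ⊔ y) = S₁ x ⊔ S₁ y) ∧ (∀ x : X₁, ‖S₁ x‖ = ‖x‖) ∧
      (∀ x y : X₂, S₂ (x ⊔ y) = S₂ x ⊔ S₂ y) ∧ (∀ x : X₂, ‖S₂ x‖ = ‖x‖) ∧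
      (∀ x : X₀, S₁ (T₁ x) = S₂ (T₂ x)) := by
  let Y := (C : ULift.{u} (AmalgamCone T₁ T₂)) → C.down.Fiber
  let R : X₁ × X₂ →ₗ[ℝ] Y := LinearMap.pi fun C => C.down.cone.nullSubspace.mkQ
  let R₁ : X₁ →ₗ[ℝ] Y := R ∘ₗ LinearMap.inl ℝ X₁ X₂
  let R₂ : X₂ →ₗ[ℝ] Y := R ∘ₗ LinearMap.inr ℝ X₁ X₂
  have hR : ∀ u v, R (u, v) = R₁ u + R₂ v := fun u v => by
    rw [LinearMap.comp_apply, LinearMap.comp_apply, ← map_add]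
    simp
  have key : ∀ c : X₁ × X₂, 0 ≤ R c → ∃ w, 0 ≤ c + (T₁ w, -T₂ w) := fun c hc =>
    AmalgamCone.exists_interpolant hT₁sup hT₂sup fun C => (C.mkQ_nonneg_iff c).1 (hc ⟨C⟩)
  obtain ⟨X₃, i₁, i₂, i₃, i₄, i₅, i₆, i₇, i₈, S₁, S₂, hS₁, hS₁n, hS₂, hS₂n, hS⟩ :=
    exists_isometric_factorization R₁ R₂
      (fun x y => funext fun C => C.down.mkQ_inl_sup x y)
      (fun x y => funext fun C => C.down.mkQ_inr_sup x y)
      (fun x u v hx _ hv h => by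
        obtain ⟨w, hw⟩ := key (u - x, v) (by
          rw [hR, map_sub, sub_add_eq_add_sub]
          exact sub_nonneg.2 h)
        have hw₁ : 0 ≤ u - x + T₁ w := hw.1
        have hw₂ : 0 ≤ v + -T₂ w := hw.2
        refine norm_le_add_norm_of_interpolant hT₁sup hT₂sup hT₁iso hT₂iso hx hv (w := w) ?_ ?_
        · rwa [sub_add_eq_add_sub, sub_nonneg] at hw₁
        · rwa [← sub_eq_add_neg, sub_nonneg] at hw₂)
      (fun x u v hx hu _ h => by
        obtain ⟨w, hw⟩ := key (u, v - x) (by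
          rw [hR, map_sub, ← add_sub_assoc]
          exact sub_nonneg.2 h)
        have hw₁ : 0 ≤ u + T₁ w := hw.1
        have hw₂ : 0 ≤ v - x + -T₂ w := hw.2
        rw [add_comm]
        refine norm_le_add_norm_of_interpolant hT₂sup hT₁sup hT₂iso hT₁iso hx hu (w := -w) ?_ ?_
        · rwa [map_neg, ← sub_nonneg, ← sub_add_eq_add_sub]
        · rwa [map_neg, neg_le_iff_add_nonneg])
  exact ⟨X₃, i₁, i₂, i₃, i₄, i₅, i₆, i₇, i₈, S₁, S₂, hS₁, hS₁n, hS₂, hS₂n,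
    fun x => hS _ _ (funext fun C => C.down.mkQ_rel x)⟩
end

section
/- Let E be a real Banach space and let B_{E*} denote the closed unit ball of its dual E*, equipped with the weak* topology. Let C_ph(B_{E*}, w*) denote the vector lattice of all real-valued functions on B_{E*} that are continuous for the weak* topology and positively homogeneous (f(t x*) = t f(x*) whenever x*, t x* ∈ B_{E*} and t ≥ 0), with pointwise order and lattice operations. Then C_ph(B_{E*}, w*) satisfies the σ-bounded chain condition: the positive cone { f ∈ C_ph(B_{E*}, w*) : f ≥ 0 } admits a countable decomposition into sets F₂, F₃, F₄, … such that for every n ≥ 2, every subset G ⊆ Fₙ of cardinality n contains two distinct elements f, g with f ∧ g ≠ 0 (i.e. min(f, g) is not the zero function). -/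
/-- The closed unit ball of the dual of `E`, as a subset of the weak* dual. -/
def dualBall (E : Type*) [NormedAddCommGroup E] [NormedSpace ℝ E] : Set (WeakDual ℝ E) :=
  {φ | ‖WeakDual.toStrongDual φ‖ ≤ 1}

/-- A function on the dual ball is positively homogeneous if `f (t • φ) = t * f φ`
whenever `t ≥ 0` and both `φ` and `t • φ` lie in the ball. -/
def PosHomog {E : Type*} [NormedAddCommGroup E] [NormedSpace ℝ E]
    (f : dualBall E → ℝ) : Prop :=
  ∀ (t : ℝ), 0 ≤ t → ∀ (φ : WeakDual ℝ E) (h1 : φ ∈ dualBall E) (h2 : t • φ ∈ dualBall E),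
    f ⟨t • φ, h2⟩ = t * f ⟨φ, h1⟩

/-- `C_ph(B_{E*}, w*)`: weak*-continuous positively homogeneous real functions on the
dual ball. -/
def Cph (E : Type*) [NormedAddCommGroup E] [NormedSpace ℝ E] : Set (dualBall E → ℝ) :=
  {f | Continuous f ∧ PosHomog f}

/-- In a large enough finite set with a coloring of ordered pairs, there are an element `l` and a
set `T` of prescribed size such that among any two elements of `T` one does not distinguish the
other from `l`. -/
theorem exists_endHomogeneous (C : Type*) [Fintype C] (L : ℕ) :
    ∃ N : ℕ, ∀ {α : Type*} (c : α → α → C) (S : Finset α), N ≤ S.card →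
      ∃ l ∈ S, ∃ T ⊆ S, l ∉ T ∧ T.card = L ∧
        ∀ i ∈ T, ∀ j ∈ T, i ≠ j → c i j = c i l ∨ c j i = c j l := by
  classical
  induction L with
  | zero =>
    refine ⟨1, fun c S hS => ?_⟩
    obtain ⟨l, hl⟩ := Finset.card_pos.mp hS
    exact ⟨l, hl, ∅, by simp, by simp, by simp, by simp⟩
  | succ L ih =>
    obtain ⟨N, hN⟩ := ih
    refine ⟨Fintype.card C * N + 2, fun c S hS => ?_⟩
    obtain ⟨v, hv⟩ := Finset.card_pos.mp (by lia : 0 < S.card)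
    have hcard : (Finset.univ : Finset C).card * N < (S.erase v).card := by
      rw [Finset.card_erase_of_mem hv, Finset.card_univ]
      lia
    obtain ⟨y, -, hy⟩ := Finset.exists_lt_card_fiber_of_mul_lt_card_of_maps_to
      (f := c v) (fun _ _ => Finset.mem_univ _) hcard
    obtain ⟨l, hl, T, hT, hlT, hTc, hTh⟩ := hN c _ hy.le
    simp only [Finset.subset_iff, Finset.mem_filter, Finset.mem_erase] at hl hT
    have hvT : v ∉ T := fun h => (hT h).1.1 rfl
    refine ⟨l, hl.1.2, insert v T, ?_, ?_, ?_, ?_⟩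
    · exact Finset.insert_subset hv fun t ht => (hT ht).1.2
    · simp [hlT, hl.1.1]
    · rw [Finset.card_insert_of_notMem hvT, hTc]
    · intro i hi j hj hij
      rcases Finset.mem_insert.mp hi with hi | hi <;>
        rcases Finset.mem_insert.mp hj with hj | hj
      · exact absurd (hi.trans hj.symm) hij
      · exact Or.inl (hi ▸ (hT hj).2.trans hl.2.symm)
      · exact Or.inr (hj ▸ (hT hi).2.trans hl.2.symm)
      · exact hTh i hi j hj hij

/-- A Ramsey-type statement: any coloring of the ordered pairs of a large enough finite set
admits `i`, `j`, `l` such that `i` does not distinguish `j` from `l` and `l` does not distinguish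
`i` from `j`. -/
theorem exists_indistinguishable_triple (C : Type*) [Fintype C] :
    ∃ N : ℕ, ∀ {α : Type*} (c : α → α → C) (S : Finset α), N ≤ S.card →
      ∃ i ∈ S, ∃ j ∈ S, ∃ l ∈ S, i ≠ l ∧ c i j = c i l ∧ c l i = c l j := by
  classical
  obtain ⟨N, hN⟩ := exists_endHomogeneous C (Fintype.card C + 1)
  refine ⟨N, fun c S hS => ?_⟩
  obtain ⟨l, hl, T, hT, hlT, hTc, hTh⟩ := hN c S hS
  obtain ⟨i, hi, j, hj, hij, hc⟩ := Finset.exists_ne_map_eq_of_card_lt_of_maps_to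
    (s := T) (t := Finset.univ) (f := c l) (by rw [hTc, Finset.card_univ]; lia)
    (fun _ _ => Finset.mem_univ _)
  have hne {t} (ht : t ∈ T) : t ≠ l := fun h => hlT (h ▸ ht)
  rcases hTh i hi j hj hij with h | h
  · exact ⟨i, hT hi, j, hT hj, l, hl, hne hi, h, hc⟩
  · exact ⟨j, hT hj, i, hT hi, l, hl, hne hj, h, hc.symm⟩

section

variable {E : Type*} [NormedAddCommGroup E] [NormedSpace ℝ E]

theorem abs_apply_le_of_mem_dualBall {φ : WeakDual ℝ E} (hφ : φ ∈ dualBall E) (x : E) :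
    |φ x| ≤ ‖x‖ := by
  have h := (WeakDual.toStrongDual φ).le_of_opNorm_le (c := 1) hφ x
  rwa [one_mul, Real.norm_eq_abs] at h

theorem mem_dualBall_of_abs_apply_le {φ : WeakDual ℝ E} (h : ∀ x, |φ x| ≤ ‖x‖) :
    φ ∈ dualBall E :=
  (WeakDual.toStrongDual φ).opNorm_le_bound zero_le_one fun x => by
    rw [one_mul]
    exact h x

/-- A function on the dual ball that is positive on the weak* neighborhood of `φ / 3` given by
`k` vectors of norm at most `M`, for some `φ` in the ball. -/
def PosNearThird (k M : ℕ) (f : dualBall E → ℝ) : Prop :=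
  ∃ φ : dualBall E, ∃ x : Fin k → E, (∀ a, ‖x a‖ ≤ M) ∧
    ∀ ψ : dualBall E, (∀ a, |ψ.1 (x a) - φ.1 (x a) / 3| < 1) → 0 < f ψ

/-- Basic weak* neighborhoods in the dual ball. -/
theorem exists_finite_nhds {U : Set (dualBall E)} (hU : IsOpen U) {θ : dualBall E} (hθ : θ ∈ U) :
    ∃ (k : ℕ) (x : Fin k → E), ∀ ψ : dualBall E, (∀ a, |ψ.1 (x a) - θ.1 (x a)| < 1) → ψ ∈ U := by
  obtain ⟨V, hV, rfl⟩ := isOpen_induced_iff.mp hU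
  obtain ⟨W, hW, rfl⟩ := isOpen_induced_iff.mp hV
  obtain ⟨I, u, hu, hI⟩ := isOpen_pi_iff.mp hW _ hθ
  have hδ (e : I) : ∃ δ > 0, Metric.ball (θ.1 e.1) δ ⊆ u e.1 :=
    Metric.isOpen_iff.mp (hu e.1 e.2).1 _ (hu e.1 e.2).2
  choose δ hδ hball using hδ
  refine ⟨I.card, fun a => (δ (I.equivFin.symm a))⁻¹ • (I.equivFin.symm a : E), fun ψ hψ => ?_⟩
  refine hI fun e he => hball ⟨e, he⟩ ?_
  have h := hψ (I.equivFin ⟨e, he⟩)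
  have hpos := hδ ⟨e, he⟩
  simp only [Equiv.symm_apply_apply, map_smul, smul_eq_mul, ← mul_sub, abs_mul, abs_inv,
    abs_of_pos hpos] at h
  rw [inv_mul_lt_iff₀ hpos, mul_one] at h
  exact h

theorem exists_posNearThird {f : dualBall E → ℝ} (hf : f ∈ Cph E) {φ : dualBall E}
    (hφ : 0 < f φ) : ∃ k M : ℕ, PosNearThird k M f := by
  have hmem : (3⁻¹ : ℝ) • φ.1 ∈ dualBall E := mem_dualBall_of_abs_apply_le fun x => by
    have h := abs_apply_le_of_mem_dualBall φ.2 x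
    have hx : ((3⁻¹ : ℝ) • φ.1) x = 3⁻¹ * φ.1 x := rfl
    rw [hx, abs_mul, abs_of_pos (by norm_num : (0 : ℝ) < 3⁻¹)]
    linarith [abs_nonneg (φ.1 x)]
  have hpos : 0 < f ⟨_, hmem⟩ := by
    rw [hf.2 3⁻¹ (by norm_num) φ.1 φ.2 hmem]
    exact mul_pos (by norm_num) hφ
  obtain ⟨k, x, hx⟩ := exists_finite_nhds (isOpen_lt continuous_const hf.1) hpos
  obtain ⟨M, hM⟩ := exists_nat_ge (∑ a, ‖x a‖)
  refine ⟨k, M, φ, x, fun a => ?_, fun ψ hψ => hx ψ fun a => ?_⟩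
  · exact (Finset.single_le_sum (fun _ _ => norm_nonneg _) (Finset.mem_univ a)).trans hM
  · have hxa : ((3⁻¹ : ℝ) • φ.1) (x a) = φ.1 (x a) / 3 := (div_eq_inv_mul _ _).symm
    rw [hxa]
    exact hψ a

theorem exists_common_pos (k M : ℕ) : ∃ N : ℕ, ∀ S : Finset (dualBall E → ℝ),
    (∀ f ∈ S, PosNearThird k M f) → N ≤ S.card →
      ∃ f ∈ S, ∃ g ∈ S, f ≠ g ∧ ∃ ψ, 0 < f ψ ∧ 0 < g ψ := by
  obtain ⟨N, hN⟩ := exists_indistinguishable_triple (Fin k → Finset.Icc (-M : ℤ) M)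
  refine ⟨N, fun S hS hcard => ?_⟩
  choose φ x hx hpos using fun f : S => hS f.1 f.2
  have hfloor (f g : S) (a : Fin k) : ⌊(φ g).1 (x f a)⌋ ∈ Finset.Icc (-M : ℤ) M := by
    have h := abs_le.mp ((abs_apply_le_of_mem_dualBall (φ g).2 (x f a)).trans (hx f a))
    rw [Finset.mem_Icc]
    constructor
    · exact Int.le_floor.mpr (by push_cast; exact h.1)
    · exact Int.cast_le.mp ((Int.floor_le _).trans (by push_cast; exact h.2) :
        ((⌊(φ g).1 (x f a)⌋ : ℤ) : ℝ) ≤ ((M : ℤ) : ℝ))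
  obtain ⟨i, -, j, -, l, -, hil, h1, h2⟩ :=
    hN (fun f g a => ⟨⌊(φ g).1 (x f a)⌋, hfloor f g a⟩) Finset.univ (by simpa using hcard)
  have hclose1 (a) : |(φ j).1 (x i a) - (φ l).1 (x i a)| < 1 :=
    Int.abs_sub_lt_one_of_floor_eq_floor (Subtype.ext_iff.mp (congrFun h1 a))
  have hclose2 (a) : |(φ i).1 (x l a) - (φ j).1 (x l a)| < 1 :=
    Int.abs_sub_lt_one_of_floor_eq_floor (Subtype.ext_iff.mp (congrFun h2 a))
  let ψ : WeakDual ℝ E := (3⁻¹ : ℝ) • ((φ i).1 - (φ j).1 + (φ l).1)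
  have hψ (e : E) : ψ e = 3⁻¹ * ((φ i).1 e - (φ j).1 e + (φ l).1 e) := rfl
  have hmem : ψ ∈ dualBall E := mem_dualBall_of_abs_apply_le fun e => by
    have hi := abs_le.mp (abs_apply_le_of_mem_dualBall (φ i).2 e)
    have hj := abs_le.mp (abs_apply_le_of_mem_dualBall (φ j).2 e)
    have hl := abs_le.mp (abs_apply_le_of_mem_dualBall (φ l).2 e)
    rw [hψ, abs_le]
    constructor <;> linarith
  refine ⟨i, i.2, l, l.2, fun h => hil (Subtype.ext h), ⟨ψ, hmem⟩, hpos i _ fun a => ?_,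
    hpos l _ fun a => ?_⟩
  · have h := abs_lt.mp (hclose1 a)
    rw [hψ, abs_lt]
    constructor <;> linarith
  · have h := abs_lt.mp (hclose2 a)
    rw [hψ, abs_lt]
    constructor <;> linarith

end

/-- `C_ph(B_{E*}, w*)` satisfies the σ-bounded chain condition: its positive cone splits
into countably many pieces `F₂, F₃, …` such that every `n`-element subset of `Fₙ` contains
two distinct functions whose pointwise minimum is not identically zero. -/
theorem cph_sigma_bcc (E : Type*) [NormedAddCommGroup E] [NormedSpace ℝ E] :
    ∃ F : ℕ → Set (dualBall E → ℝ),
      ({f ∈ Cph E | ∀ φ, 0 ≤ f φ} = ⋃ n : ℕ, F (n + 2)) ∧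
      ∀ n : ℕ, ∀ G ⊆ F (n + 2), G.ncard = n + 2 →
        ∃ f ∈ G, ∃ g ∈ G, f ≠ g ∧ (fun φ => min (f φ) (g φ)) ≠ fun _ => 0 := by
  classical
  choose N hN using exists_common_pos (E := E)
  let size (m : ℕ) : ℕ := Nat.pair m (N m.unpair.1 m.unpair.2)
  refine ⟨fun n => {f | (f ∈ Cph E ∧ ∀ φ, 0 ≤ f φ) ∧ ∃ m, n = size m + 2 ∧
    (f = 0 ∨ PosNearThird m.unpair.1 m.unpair.2 f)}, ?_, ?_⟩
  · ext f
    simp only [Set.mem_ofPred_eq, Set.mem_iUnion]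
    refine ⟨fun hf => ?_, fun ⟨_, hf, _⟩ => hf⟩
    by_cases h0 : f = 0
    · exact ⟨size 0, hf, 0, rfl, Or.inl h0⟩
    · obtain ⟨φ, hφ⟩ := Function.ne_iff.mp h0
      obtain ⟨k, M, hkM⟩ := exists_posNearThird hf.1 ((hf.2 φ).lt_of_ne' hφ)
      exact ⟨size (Nat.pair k M), hf, Nat.pair k M, rfl, Or.inr (by simpa using hkM)⟩
  · intro n G hG hcard
    obtain ⟨f₀, hf₀⟩ := Set.nonempty_of_ncard_ne_zero (by lia : G.ncard ≠ 0)
    obtain ⟨-, m, hm, -⟩ := hG hf₀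
    obtain rfl : n = size m := by lia
    have hfin : G.Finite := Set.finite_of_ncard_ne_zero (by lia)
    rw [Set.ncard_eq_toFinset_card G hfin] at hcard
    obtain ⟨f, hf, g, hg, hfg, ψ, hfψ, hgψ⟩ := hN m.unpair.1 m.unpair.2 (hfin.toFinset.erase 0)
      (fun f hf => by
        obtain ⟨hf0, hfG⟩ := Finset.mem_erase.mp hf
        obtain ⟨-, m', hm', h⟩ := hG (hfin.mem_toFinset.mp hfG)
        obtain rfl : m = m' := (Nat.pair_eq_pair.mp (by lia : size m = size m')).1
        exact h.resolve_left hf0)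
      (by
        have h1 := Finset.pred_card_le_card_erase (s := hfin.toFinset) (a := 0)
        have h2 : N m.unpair.1 m.unpair.2 ≤ size m := Nat.right_le_pair _ _
        lia)
    refine ⟨f, hfin.mem_toFinset.mp (Finset.mem_of_mem_erase hf), g,
      hfin.mem_toFinset.mp (Finset.mem_of_mem_erase hg), hfg, fun h => ?_⟩
    exact (lt_min hfψ hgψ).ne' (congrFun h ψ)
end
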